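/- arXiv:2501.00762 — 2 statements merged into one kernel-verified Lean document; each statement's English description precedes it below -/
import Mathlib

section
/- Fix b ≥ 0 and let γ denote the standard Gaussian measure on ℝ (density (2π)^{-1/2} e^{-η²/2}). Then the function f : (0, ∞) → ℝ defined by f(a) = ∫_ℝ log((a + η)² + b) dγ(η) is strictly monotonically increasing on (0, ∞). -/
open MeasureTheory ProbabilityTheory

lemma gaussianReal_le_volume (m : ℝ) : gaussianReal m 1 ≤ volume := by
  rw [gaussianReal_of_var_ne_zero m one_ne_zero]
  refine (withDensity_mono (g := 1) (ae_of_all _ fun x => ?_)).trans withDensity_one.le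
  simp only [gaussianPDF, Pi.one_apply, ENNReal.ofReal_le_one, gaussianPDFReal]
  refine mul_le_one₀ (inv_le_one_of_one_le₀ ?_) (Real.exp_nonneg _) (Real.exp_le_one_iff.2 ?_)
  · rw [Real.one_le_sqrt]
    push_cast
    linarith [Real.pi_gt_three]
  · push_cast
    nlinarith [sq_nonneg (x - m)]

lemma integrable_log_sq_add_gaussianReal {b : ℝ} (hb : 0 ≤ b) (m : ℝ) :
    Integrable (fun x : ℝ => Real.log (x ^ 2 + b)) (gaussianReal m 1) := by
  have hsq : Integrable (fun x : ℝ => x ^ 2 + b) (gaussianReal m 1) :=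
    (memLp_id_gaussianReal (μ := m) (v := 1) 2).integrable_sq.add (integrable_const b)
  have hlog : Integrable ((Set.Ioc (-1 : ℝ) 1).indicator fun x => 2 * |Real.log x|)
      (gaussianReal m 1) := by
    refine Integrable.mono_measure ?_ (gaussianReal_le_volume m)
    rw [integrable_indicator_iff measurableSet_Ioc]
    have h : IntervalIntegrable Real.log volume (-1) 1 := intervalIntegral.intervalIntegrable_log'
    exact (((intervalIntegrable_iff_integrableOn_Ioc_of_le (by norm_num)).1 h).abs).const_mul 2
  have hne : ∀ᵐ x ∂gaussianReal m 1, x ≠ 0 :=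
    (gaussianReal_le_volume m).absolutelyContinuous.ae_le (Measure.ae_ne volume 0)
  refine (hsq.add hlog).mono'
    (Real.measurable_log.comp (by fun_prop : Measurable fun x : ℝ => x ^ 2 + b)).aestronglyMeasurable
    (hne.mono fun x hx => ?_)
  have hind : 0 ≤ (Set.Ioc (-1 : ℝ) 1).indicator (fun x => 2 * |Real.log x|) x :=
    Set.indicator_nonneg (fun _ _ => by positivity) x
  have hpos : 0 ≤ x ^ 2 + b := by positivity
  have hupper : Real.log (x ^ 2 + b) ≤ x ^ 2 + b := Real.log_le_self hpos
  rw [Real.norm_eq_abs, Pi.add_apply, abs_le]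
  refine ⟨?_, by linarith⟩
  have hx2 : 0 < x ^ 2 := by positivity
  have hlower : 2 * Real.log x ≤ Real.log (x ^ 2 + b) := by
    have := Real.log_le_log hx2 (le_add_of_nonneg_right hb)
    rwa [Real.log_pow] at this
  by_cases hmem : x ∈ Set.Ioc (-1 : ℝ) 1
  · rw [Set.indicator_of_mem hmem]
    linarith [neg_abs_le (Real.log x)]
  · rw [Set.indicator_of_notMem hmem]
    have : 1 ≤ x ^ 2 + b := by
      have : 1 ≤ |x| := by
        by_contra! h
        exact hmem ⟨(abs_lt.1 h).1, (abs_lt.1 h).2.le⟩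
      nlinarith [sq_abs x]
    linarith [Real.log_nonneg this]

lemma integrable_gaussianPDFReal_mul_log_sq_add {b : ℝ} (hb : 0 ≤ b) (m s : ℝ) :
    Integrable fun x : ℝ => gaussianPDFReal m 1 x * Real.log ((x + s) ^ 2 + b) := by
  have h := integrable_log_sq_add_gaussianReal hb (m + s)
  rw [← gaussianReal_map_add_const s, (measurableEmbedding_addRight s).integrable_map_iff,
    gaussianReal_of_var_ne_zero m one_ne_zero,
    integrable_withDensity_iff_integrable_smul' (measurable_gaussianPDF m 1)
      (ae_of_all _ fun _ => gaussianPDF_lt_top)] at h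
  simpa only [toReal_gaussianPDF, smul_eq_mul, Function.comp_apply] using h

lemma integral_log_sq_add_gaussianReal_eq (b m s : ℝ) :
    ∫ η, Real.log ((m + s + η) ^ 2 + b) ∂(gaussianReal 0 1) =
      ∫ x, gaussianPDFReal m 1 x * Real.log ((x + s) ^ 2 + b) := by
  have h := integral_gaussianReal_eq_integral_smul (μ := m) (v := 1)
    (f := fun x => Real.log ((x + s) ^ 2 + b)) one_ne_zero
  simp only [smul_eq_mul] at h
  rw [← h, ← zero_add m, ← gaussianReal_map_add_const m,
    (measurableEmbedding_addRight m).integral_map]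
  simp only [zero_add]
  congr! 4 with η
  ring

lemma integral_log_sq_add_gaussianReal_neg (b a : ℝ) :
    ∫ η, Real.log ((-a + η) ^ 2 + b) ∂(gaussianReal 0 1) =
      ∫ η, Real.log ((a + η) ^ 2 + b) ∂(gaussianReal 0 1) := by
  have h : (gaussianReal 0 1).map (fun x : ℝ => -x) = gaussianReal 0 1 := by
    rw [gaussianReal_map_neg, neg_zero]
  have hmap := (Homeomorph.neg ℝ).measurableEmbedding.integral_map (μ := gaussianReal 0 1)
    fun η => Real.log ((-a + η) ^ 2 + b)
  change ∫ η, _ ∂(gaussianReal 0 1).map (fun x : ℝ => -x) =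
    ∫ η : ℝ, Real.log ((-a + -η) ^ 2 + b) ∂(gaussianReal 0 1) at hmap
  rw [h] at hmap
  simpa only [← neg_add, neg_sq] using hmap

lemma gaussianPDFReal_neg_mean_lt {c x : ℝ} (hc : 0 < c) (hx : 0 < x) :
    gaussianPDFReal (-c) 1 x < gaussianPDFReal c 1 x := by
  unfold gaussianPDFReal
  gcongr 1
  refine Real.exp_lt_exp.2 ?_
  push_cast
  nlinarith [mul_pos hc hx]

lemma gaussianPDFReal_neg_mean (c x : ℝ) :
    gaussianPDFReal (-c) 1 x = gaussianPDFReal c 1 (-x) := by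
  unfold gaussianPDFReal
  congr 3
  ring

lemma log_sq_sub_lt_log_sq_add {b d x : ℝ} (hb : 0 ≤ b) (hd : 0 < d) (hx : 0 < x) (hxd : x ≠ d) :
    Real.log ((x - d) ^ 2 + b) < Real.log ((x + d) ^ 2 + b) := by
  have : x - d ≠ 0 := sub_ne_zero.2 hxd
  exact Real.log_lt_log (by positivity) (by nlinarith [mul_pos hd hx])

/-- Both factors are odd in `x`, and both are positive for `x > 0` away from `x = d`. -/
lemma gaussianPDFReal_sub_mul_log_sub_pos {b c d x : ℝ} (hb : 0 ≤ b) (hc : 0 < c) (hd : 0 < d)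
    (hx : x ≠ 0) (hxd : x ≠ d) (hxd' : x ≠ -d) :
    0 < (gaussianPDFReal c 1 x - gaussianPDFReal (-c) 1 x) *
      (Real.log ((x + d) ^ 2 + b) - Real.log ((x - d) ^ 2 + b)) := by
  rcases hx.lt_or_gt with h | h
  · have hp : gaussianPDFReal c 1 x < gaussianPDFReal (-c) 1 x := by
      simpa only [gaussianPDFReal_neg_mean, neg_neg] using
        gaussianPDFReal_neg_mean_lt hc (neg_pos.2 h)
    have hl := log_sq_sub_lt_log_sq_add hb hd (neg_pos.2 h) (fun h => hxd' (by linarith))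
    rw [show (-x - d) ^ 2 = (x + d) ^ 2 by ring, show (-x + d) ^ 2 = (x - d) ^ 2 by ring] at hl
    exact mul_pos_of_neg_of_neg (sub_neg.2 hp) (sub_neg.2 hl)
  · exact mul_pos (sub_pos.2 (gaussianPDFReal_neg_mean_lt hc h))
      (sub_pos.2 (log_sq_sub_lt_log_sq_add hb hd h hxd))

theorem stmt15 (b : ℝ) (hb : 0 ≤ b) :
    StrictMonoOn
      (fun a : ℝ => ∫ η, Real.log ((a + η) ^ 2 + b) ∂(gaussianReal 0 1))
      (Set.Ioi (0 : ℝ)) := by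
  intro a₁ ha₁ a₂ _ hlt
  rw [Set.mem_Ioi] at ha₁
  set F : ℝ → ℝ := fun a => ∫ η, Real.log ((a + η) ^ 2 + b) ∂(gaussianReal 0 1)
  obtain ⟨c, d, hc, hd, rfl, rfl⟩ : ∃ c d : ℝ, 0 < c ∧ 0 < d ∧ a₁ = c + -d ∧ a₂ = c + d :=
    ⟨(a₁ + a₂) / 2, (a₂ - a₁) / 2, by linarith, by linarith, by ring, by ring⟩
  let I : ℝ → ℝ → ℝ → ℝ := fun m s x => gaussianPDFReal m 1 x * Real.log ((x + s) ^ 2 + b)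
  have hI (m s : ℝ) : Integrable (I m s) := integrable_gaussianPDFReal_mul_log_sq_add hb m s
  have hFI (m s : ℝ) : F (m + s) = ∫ x, I m s x := integral_log_sq_add_gaussianReal_eq b m s
  have hneg (a : ℝ) : F (-a) = F a := integral_log_sq_add_gaussianReal_neg b a
  have hdiff (m : ℝ) : Integrable (fun x => I m d x - I m (-d) x) := (hI m d).sub (hI m (-d))
  have hint : Integrable (fun x => (I c d x - I c (-d) x) - (I (-c) d x - I (-c) (-d) x)) :=
    (hdiff c).sub (hdiff (-c))
  have hsum : ∫ x, ((I c d x - I c (-d) x) - (I (-c) d x - I (-c) (-d) x)) =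
      2 * (F (c + d) - F (c + -d)) := by
    rw [integral_sub (hdiff c) (hdiff (-c)),
      integral_sub (hI c d) (hI c (-d)), integral_sub (hI (-c) d) (hI (-c) (-d)),
      ← hFI, ← hFI, ← hFI, ← hFI, ← hneg (-c + d), ← hneg (-c + -d)]
    simp only [neg_add, neg_neg]
    ring
  have hpos : ∀ᵐ x : ℝ, 0 < (I c d x - I c (-d) x) - (I (-c) d x - I (-c) (-d) x) := by
    filter_upwards [Measure.ae_ne volume 0, Measure.ae_ne volume d,
      Measure.ae_ne volume (-d)] with x h0 h1 h2
    refine (gaussianPDFReal_sub_mul_log_sub_pos hb hc hd h0 h1 h2).trans_eq ?_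
    simp only [I, ← sub_eq_add_neg]
    ring
  have : 0 < 2 * (F (c + d) - F (c + -d)) := by
    rw [← hsum]
    refine (integral_nonneg_of_ae (hpos.mono fun _ => le_of_lt)).lt_of_ne' fun h => ?_
    rw [integral_eq_zero_iff_of_nonneg_ae (hpos.mono fun _ => le_of_lt) hint] at h
    obtain ⟨x, hx, hx'⟩ := (h.and hpos).exists
    exact hx'.ne' hx
  linarith
end

section
/- Let r > 0, α > 0 with αr < 1, and let P be a Borel probability measure on ℝ that is symmetric (P(B) = P(−B) for every Borel set B) and supported in [−r, r]. Then for every λ ∈ (−1, 1), ∫_ℝ log|1 + αλw| dP(w) ≥ ∫_ℝ log|1 + αw| dP(w). -/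
open MeasureTheory

/-- Logarithms of affine functions that stay away from zero on the support are integrable. -/
lemma integrable_log_abs_one_add_mul {r c : ℝ} (hcr : |c| * r < 1)
    (P : Measure ℝ) [IsFiniteMeasure P] (hsupp : ∀ᵐ w ∂P, |w| ≤ r) :
    Integrable (fun w => Real.log |1 + c * w|) P := by
  refine Integrable.of_mem_Icc (Real.log (1 - |c| * r)) (Real.log (1 + |c| * r))
    (by fun_prop) ?_
  filter_upwards [hsupp] with w hw
  have h : |c * w| ≤ |c| * r := by
    rw [abs_mul]
    gcongr
  obtain ⟨h₁, h₂⟩ := abs_le.mp h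
  rw [abs_of_pos (show 0 < 1 + c * w by linarith)]
  exact ⟨Real.log_le_log (by linarith) (by linarith),
    Real.log_le_log (by linarith) (by linarith)⟩

/-- Reflecting a symmetric measure flips the sign of the slope. -/
lemma integral_log_abs_one_add_neg_mul {c : ℝ} (P : Measure ℝ)
    (hsymm : Measure.map (fun x : ℝ => -x) P = P) :
    ∫ w, Real.log |1 + -c * w| ∂P = ∫ w, Real.log |1 + c * w| ∂P := by
  conv_rhs => rw [← hsymm]
  rw [integral_map (by fun_prop)
    (Measurable.aestronglyMeasurable (by fun_prop))]
  simp

theorem stmt19 (r α : ℝ) (hr : 0 < r) (hα : 0 < α) (hαr : α * r < 1)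
    (P : Measure ℝ) [IsProbabilityMeasure P]
    (hsymm : Measure.map (fun x : ℝ => -x) P = P)
    (hsupp : ∀ᵐ w ∂P, |w| ≤ r)
    (lam : ℝ) (hlam : lam ∈ Set.Ioo (-1 : ℝ) 1) :
    ∫ w, Real.log |1 + α * w| ∂P ≤ ∫ w, Real.log |1 + α * lam * w| ∂P := by
  have hlam_abs : |lam| < 1 := abs_lt.mpr hlam
  have hα_abs : |α| * r < 1 := by rwa [abs_of_pos hα]
  have hαlam : |α * lam| * r < 1 := by
    rw [abs_mul, abs_of_pos hα]
    nlinarith [mul_pos hα hr]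
  have hint {c : ℝ} (hc : |c| * r < 1) := integrable_log_abs_one_add_mul hc P hsupp
  have hint_neg {c : ℝ} (hc : |c| * r < 1) := hint (c := -c) (by rwa [abs_neg])
  have hsum : ∫ w, (Real.log |1 + α * w| + Real.log |1 + -α * w|) ∂P ≤
      ∫ w, (Real.log |1 + α * lam * w| + Real.log |1 + -(α * lam) * w|) ∂P := by
    refine integral_mono_ae ((hint hα_abs).add (hint_neg hα_abs))
      ((hint hαlam).add (hint_neg hαlam)) ?_
    filter_upwards [hsupp] with w hw
    have hαw : |α * w| < 1 := by
      rw [abs_mul, abs_of_pos hα]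
      nlinarith
    have hle : (α * lam * w) ^ 2 ≤ (α * w) ^ 2 := by
      have : lam ^ 2 ≤ 1 := by nlinarith [hlam.1, hlam.2]
      nlinarith [mul_nonneg (sq_nonneg (α * w)) (sub_nonneg.mpr this)]
    have hαlamw : |α * lam * w| < 1 := (sq_le_sq.mp hle).trans_lt hαw
    obtain ⟨h₁, h₂⟩ := abs_lt.mp hαw
    obtain ⟨h₃, h₄⟩ := abs_lt.mp hαlamw
    simp only [Real.log_abs, neg_mul]
    rw [← Real.log_mul (by linarith) (by linarith), ← Real.log_mul (by linarith) (by linarith)]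
    exact Real.log_le_log (mul_pos (by linarith) (by linarith)) (by nlinarith)
  rw [integral_add (hint hα_abs) (hint_neg hα_abs),
    integral_add (hint hαlam) (hint_neg hαlam),
    integral_log_abs_one_add_neg_mul P hsymm, integral_log_abs_one_add_neg_mul P hsymm] at hsum
  linarith
end
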